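/- Let G be a connected graph on n vertices and m edges with diameter 2, and suppose G has exactly k vertices of degree n-1. Then 2W_ε(G) = 2(n²-n-2m) + k(2n-k-1), where W_ε(G) is the ε-Wiener index of G. -/

import Mathlib

open Finset SimpleGraph

variable {V : Type*}

/-- The eccentricity of a vertex: the largest distance to another vertex. -/
noncomputable def ecc [Fintype V] (G : SimpleGraph V) (u : V) : ℕ :=
  Finset.univ.sup fun v => G.dist u v

/-- The diameter of a graph: the largest eccentricity. -/
noncomputable def gdiam [Fintype V] (G : SimpleGraph V) : ℕ :=
  Finset.univ.sup fun u => ecc G u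

/-- The eccentricity matrix: keep the distance `d(u,v)` if it equals
`min (e u) (e v)`, and put `0` otherwise. -/
noncomputable def eccMatrix [Fintype V] (G : SimpleGraph V) : Matrix V V ℝ :=
  Matrix.of fun u v =>
    if G.dist u v = min (ecc G u) (ecc G v) then (G.dist u v : ℝ) else 0

/-- The distance matrix of a graph. -/
noncomputable def distMatrix [Fintype V] (G : SimpleGraph V) : Matrix V V ℝ :=
  Matrix.of fun u v => (G.dist u v : ℝ)

/-- A vertex has degree `|V| - 1` exactly when it is adjacent to every other vertex. -/
lemma degree_eq_card_sub_one_iff_forall_adj [Fintype V] [DecidableEq V] (G : SimpleGraph V)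
    [DecidableRel G.Adj] (u : V) :
    G.degree u = Fintype.card V - 1 ↔ ∀ v, u ≠ v → G.Adj u v := by
  have hsub : G.neighborFinset u ⊆ univ.erase u := fun v hv => by
    rw [mem_neighborFinset] at hv
    simp [hv.ne']
  have hcard : (univ.erase u).card = Fintype.card V - 1 := by
    rw [card_erase_of_mem (mem_univ u), card_univ]
  rw [← hcard, ← card_neighborFinset_eq_degree]
  constructor
  · intro h v huv
    have hv : v ∈ univ.erase u := by simp [huv.symm]
    rw [← eq_of_subset_of_card_le hsub h.ge] at hv
    simpa using hv
  · intro h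
    congr 1
    refine hsub.antisymm fun v hv => ?_
    rw [mem_neighborFinset]
    exact h v (by simpa using (ne_of_mem_erase hv).symm)

lemma dist_le_ecc [Fintype V] (G : SimpleGraph V) (u v : V) : G.dist u v ≤ ecc G u :=
  le_sup (f := fun v => G.dist u v) (mem_univ v)

lemma ecc_le_gdiam [Fintype V] (G : SimpleGraph V) (u : V) : ecc G u ≤ gdiam G :=
  le_sup (f := fun u => ecc G u) (mem_univ u)

/-- In a connected graph of diameter 2, distinct non-adjacent vertices are at distance 2. -/
lemma dist_eq_two_of_not_adj [Fintype V] {G : SimpleGraph V} (hG : G.Connected)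
    (hd : gdiam G = 2) {u v : V} (huv : u ≠ v) (hadj : ¬ G.Adj u v) : G.dist u v = 2 := by
  have h₁ : G.dist u v ≠ 1 := fun h => hadj (dist_eq_one_iff_adj.mp h)
  have h₀ := hG.pos_dist_of_ne huv
  have h₂ := (dist_le_ecc G u v).trans (ecc_le_gdiam G u)
  omega

/-- In a connected graph of diameter 2, a vertex has eccentricity 1 if it is adjacent to every
other vertex, and 2 otherwise. -/
lemma ecc_of_gdiam_eq_two [Fintype V] [DecidableEq V] {G : SimpleGraph V} [DecidableRel G.Adj]
    (hG : G.Connected) (hd : gdiam G = 2) (u : V) :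
    ecc G u = if G.degree u = Fintype.card V - 1 then 1 else 2 := by
  rw [if_congr (degree_eq_card_sub_one_iff_forall_adj G u) rfl rfl]
  split_ifs with h
  · apply le_antisymm
    · refine Finset.sup_le fun v _ => ?_
      by_cases huv : u = v
      · simp [huv]
      · exact (dist_eq_one_iff_adj.mpr (h v huv)).le
    · by_contra! hlt
      have hall : ∀ v, u = v := fun v => by
        by_contra huv
        have := hG.pos_dist_of_ne huv
        have := dist_le_ecc G u v
        omega
      have : gdiam G ≤ 0 := Finset.sup_le fun x _ => Finset.sup_le fun y _ => by
        simp [← hall x, ← hall y]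
      omega
  · push Not at h
    obtain ⟨v, huv, hadj⟩ := h
    have h₁ := dist_eq_two_of_not_adj hG hd huv hadj
    have h₂ := dist_le_ecc G u v
    have h₃ := ecc_le_gdiam G u
    omega

/-- The entries of the eccentricity matrix of a connected graph of diameter 2, in terms of the
indicators of equality, of adjacency and of having full degree. -/
lemma eccMatrix_apply_of_gdiam_eq_two [Fintype V] [DecidableEq V] {G : SimpleGraph V}
    [DecidableRel G.Adj] (hG : G.Connected) (hd : gdiam G = 2) (u v : V) :
    let U : V → ℝ := fun w => if G.degree w = Fintype.card V - 1 then 1 else 0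
    eccMatrix G u v = 2 * (1 - (if u = v then 1 else 0) - (if G.Adj u v then 1 else 0)) +
      (U u + U v - U u * U v - if u = v then U u else 0) := by
  intro U
  simp only [U, eccMatrix, Matrix.of_apply, ecc_of_gdiam_eq_two hG hd]
  by_cases huv : u = v
  · subst huv
    by_cases hu : G.degree u = Fintype.card V - 1 <;> simp [hu]
  by_cases hadj : G.Adj u v
  · rw [dist_eq_one_iff_adj.mpr hadj]
    by_cases hu : G.degree u = Fintype.card V - 1 <;>
      by_cases hv : G.degree v = Fintype.card V - 1 <;> simp [hu, hv, huv, hadj]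
  · have hu : G.degree u ≠ Fintype.card V - 1 := fun h =>
      hadj ((degree_eq_card_sub_one_iff_forall_adj G u).mp h v huv)
    have hv : G.degree v ≠ Fintype.card V - 1 := fun h =>
      hadj ((degree_eq_card_sub_one_iff_forall_adj G v).mp h u (Ne.symm huv)).symm
    simp [dist_eq_two_of_not_adj hG hd huv hadj, hu, hv, huv, hadj]

/-- For a connected graph of diameter 2 with `n` vertices, `m` edges
and exactly `k` vertices of degree `n-1`, twice the ε-Wiener index equals
`2(n²-n-2m) + k(2n-k-1)`. -/
theorem two_mul_eccWiener_of_diam_two [Fintype V] [DecidableEq V]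
    (G : SimpleGraph V) [DecidableRel G.Adj] (hG : G.Connected)
    (n m k : ℕ) (hn : Fintype.card V = n) (hm : G.edgeFinset.card = m)
    (hd : gdiam G = 2)
    (hk : (Finset.univ.filter fun v => G.degree v = n - 1).card = k) :
    2 * ((∑ u, ∑ v, eccMatrix G u v) / 2) =
      2 * ((n : ℝ) ^ 2 - n - 2 * m) + k * (2 * n - k - 1) := by
  subst hn
  have hU : (∑ w, if G.degree w = Fintype.card V - 1 then (1 : ℝ) else 0) = k := by
    rw [sum_boole, hk]
  have hadj : (∑ u, ∑ v, if G.Adj u v then (1 : ℝ) else 0) = 2 * m := by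
    have h : ∀ u, (∑ v, if G.Adj u v then (1 : ℝ) else 0) = G.degree u := fun u => by
      rw [sum_boole, ← card_neighborFinset_eq_degree, neighborFinset_eq_filter]
    simp only [h]
    exact_mod_cast hm ▸ G.sum_degrees_eq_twice_card_edges
  rw [mul_div_cancel₀ _ (two_ne_zero' ℝ)]
  simp only [eccMatrix_apply_of_gdiam_eq_two hG hd, sum_add_distrib, sum_sub_distrib, ← mul_sum,
    ← sum_mul, hU, hadj, sum_ite_eq, mem_univ, if_true, sum_const, card_univ, nsmul_eq_mul]
  ring
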